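/- arXiv:0910.1566 — 2 statements merged into one kernel-verified Lean document; each statement's English description precedes it below -/
import Mathlib

section
/- Let N be a positive integer, let ρ₀ and ρ_T be Hermitian N×N complex matrices, let U be a unitary N×N complex matrix, and let A be an anti-Hermitian N×N complex matrix (A† = −A). Then the second derivative at s = 0 of the function s ↦ Re Tr((U·exp(sA))† ρ₀ (U·exp(sA)) ρ_T) equals Re Tr({ρ_T, U†ρ₀U}·A²) − 2·Re Tr(U†ρ₀U · A · ρ_T · A), where {X,Y} = XY + YX denotes the anticommutator. -/
/-!
STATEMENT 1: For Hermitian `ρ₀ ρ_T`, unitary `U` and anti-Hermitian `A`,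
the second derivative at `s = 0` of `s ↦ Re Tr((U·exp(sA))† ρ₀ (U·exp(sA)) ρ_T)`
equals `Re Tr({ρ_T, U†ρ₀U}·A²) − 2·Re Tr(U†ρ₀U · A · ρ_T · A)`,
where `{X,Y} = XY + YX` is the anticommutator.
-/

open Matrix

noncomputable section

/-- The matrix anticommutator `{X, Y} = XY + YX`. -/
def matAntiComm {N : ℕ} (X Y : Matrix (Fin N) (Fin N) ℂ) : Matrix (Fin N) (Fin N) ℂ :=
  X * Y + Y * X

section ConjugationByExponential

open NormedSpace

theorem hasDerivAt_exp_neg_smul_mul_mul_exp_smul {𝔸 : Type*} [NormedRing 𝔸] [NormedAlgebra ℝ 𝔸]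
    [CompleteSpace 𝔸] (A M : 𝔸) (s : ℝ) :
    HasDerivAt (fun t : ℝ => exp (t • -A) * M * exp (t • A))
      (exp (s • -A) * (M * A - A * M) * exp (s • A)) s := by
  have h := ((hasDerivAt_exp_smul_const (𝕂 := ℝ) (-A) s).mul_const M).mul
    (hasDerivAt_exp_smul_const' (𝕂 := ℝ) A s)
  refine h.congr_deriv ?_
  noncomm_ring

theorem iteratedDeriv_two_exp_neg_smul_mul_mul_exp_smul {𝔸 : Type*} [NormedRing 𝔸]
    [NormedAlgebra ℝ 𝔸] [CompleteSpace 𝔸] (L : 𝔸 →L[ℝ] ℝ) (A M : 𝔸) :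
    iteratedDeriv 2 (fun s : ℝ => L (exp (s • -A) * M * exp (s • A))) 0 =
      L ((M * A - A * M) * A - A * (M * A - A * M)) := by
  have hL (K : 𝔸) : deriv (fun s : ℝ => L (exp (s • -A) * K * exp (s • A))) =
      fun s : ℝ => L (exp (s • -A) * (K * A - A * K) * exp (s • A)) :=
    funext fun s =>
      (L.hasFDerivAt.comp_hasDerivAt s (hasDerivAt_exp_neg_smul_mul_mul_exp_smul A K s)).deriv
  rw [iteratedDeriv_succ, iteratedDeriv_one, hL, hL]
  simp

end ConjugationByExponential

attribute [local instance] Matrix.linftyOpNormedRing Matrix.linftyOpNormedAlgebra in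
theorem iteratedDeriv_two_re_trace_exp_conj {n : Type*} [Fintype n] [DecidableEq n]
    (A M R : Matrix n n ℂ) :
    iteratedDeriv 2 (fun s : ℝ =>
        ((NormedSpace.exp (s • -A) * M * NormedSpace.exp (s • A) * R).trace).re) 0 =
      ((((M * A - A * M) * A - A * (M * A - A * M)) * R).trace).re := by
  let L : Matrix n n ℂ →ₗ[ℝ] ℝ :=
    Complex.reLm ∘ₗ Matrix.traceLinearMap n ℝ ℂ ∘ₗ LinearMap.mulRight ℝ R
  exact iteratedDeriv_two_exp_neg_smul_mul_mul_exp_smul (LinearMap.toContinuousLinearMap L) A M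

theorem fidelity_second_derivative
    (N : ℕ) (hN : 0 < N)
    (ρ₀ ρT : Matrix (Fin N) (Fin N) ℂ)
    (hρ₀ : ρ₀.IsHermitian) (hρT : ρT.IsHermitian)
    (U : Matrix (Fin N) (Fin N) ℂ) (hU : Uᴴ * U = 1)
    (A : Matrix (Fin N) (Fin N) ℂ) (hA : Aᴴ = -A) :
    iteratedDeriv 2
      (fun s : ℝ =>
        (((U * NormedSpace.exp (s • A))ᴴ * ρ₀ * (U * NormedSpace.exp (s • A)) * ρT).trace).re)
      0
      = ((matAntiComm ρT (Uᴴ * ρ₀ * U) * A ^ 2).trace).re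
        - 2 * ((Uᴴ * ρ₀ * U * A * ρT * A).trace).re := by
  have hexp (s : ℝ) : (U * NormedSpace.exp (s • A))ᴴ * ρ₀ * (U * NormedSpace.exp (s • A)) * ρT =
      NormedSpace.exp (s • -A) * (Uᴴ * ρ₀ * U) * NormedSpace.exp (s • A) * ρT := by
    rw [conjTranspose_mul, ← Matrix.exp_conjTranspose, conjTranspose_smul, star_trivial, hA]
    simp only [Matrix.mul_assoc]
  simp only [hexp]
  rw [iteratedDeriv_two_re_trace_exp_conj]
  generalize Uᴴ * ρ₀ * U = P
  have hleft : (A * A * P * ρT).trace = (P * ρT * (A * A)).trace := by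
    rw [Matrix.mul_assoc (A * A), Matrix.trace_mul_comm]
  have hright : (P * A * A * ρT).trace = (ρT * P * (A * A)).trace := by
    rw [Matrix.trace_mul_comm]
    simp only [Matrix.mul_assoc]
  have hmid : (A * P * A * ρT).trace = (P * A * ρT * A).trace := by
    rw [Matrix.mul_assoc, Matrix.mul_assoc, Matrix.trace_mul_comm]
    simp only [Matrix.mul_assoc]
  have hexpand : ((P * A - A * P) * A - A * (P * A - A * P)) * ρT =
      P * A * A * ρT + A * A * P * ρT - (A * P * A * ρT + A * P * A * ρT) := by
    noncomm_ring
  rw [hexpand, matAntiComm, pow_two, Matrix.add_mul]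
  simp only [Matrix.trace_sub, Matrix.trace_add, hleft, hright, hmid, Complex.add_re,
    Complex.sub_re]
  ring
end
end

section
/- Let λ₁, λ₂, λ₃, λ₄, λ₅ be nonnegative reals with λ₁² + λ₂² + λ₃² + λ₄² + λ₅² = 1, let φ ∈ ℝ, and let ψ_S = λ₁·(e₀⊗e₀⊗e₀) + λ₂·e^{iφ}·(e₀⊗e₁⊗e₁) + λ₃·(e₁⊗e₀⊗e₁) + λ₄·(e₁⊗e₁⊗e₀) + λ₅·(e₁⊗e₁⊗e₁) ∈ ℂ²⊗ℂ²⊗ℂ² be a generalized three-qubit Schmidt state. Then for all anti-Hermitian 2×2 complex matrices A₁, A₂, A₃, the derivative at s = 0 of the function s ↦ |⟨ψ_S, (exp(sA₁)⊗exp(sA₂)⊗exp(sA₃))·(e₀⊗e₀⊗e₀)⟩|² is zero; i.e., e₀⊗e₀⊗e₀ is a stationary point of the fidelity with ψ_S under local unitary transformations. -/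
open Matrix Real

noncomputable section

/-- Standard basis vectors of ℂ². -/
def e0 : Fin 2 → ℂ := ![1, 0]
def e1 : Fin 2 → ℂ := ![0, 1]

/-- First-qubit index of a three-qubit basis label, with basis order
`(e₀⊗e₀⊗e₀, e₀⊗e₀⊗e₁, e₀⊗e₁⊗e₀, e₀⊗e₁⊗e₁, e₁⊗e₀⊗e₀, e₁⊗e₀⊗e₁, e₁⊗e₁⊗e₀, e₁⊗e₁⊗e₁)`. -/
def p1 : Fin 8 → Fin 2 := ![0, 0, 0, 0, 1, 1, 1, 1]
/-- Second-qubit index of a three-qubit basis label. -/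
def p2 : Fin 8 → Fin 2 := ![0, 0, 1, 1, 0, 0, 1, 1]
/-- Third-qubit index of a three-qubit basis label. -/
def p3 : Fin 8 → Fin 2 := ![0, 1, 0, 1, 0, 1, 0, 1]

/-- Tensor (Kronecker) product of three vectors of ℂ², as a vector in ℂ⁸. -/
def vkron3 (a b c : Fin 2 → ℂ) : Fin 8 → ℂ := fun i => a (p1 i) * b (p2 i) * c (p3 i)

/-- Kronecker product of three 2×2 matrices, as an 8×8 matrix acting on ℂ²⊗ℂ²⊗ℂ² ≅ ℂ⁸. -/
def mkron3 (A B C : Matrix (Fin 2) (Fin 2) ℂ) : Matrix (Fin 8) (Fin 8) ℂ :=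
  Matrix.of fun i j => A (p1 i) (p1 j) * B (p2 i) (p2 j) * C (p3 i) (p3 j)

/-- The inner product `⟨ψ, v⟩` on ℂ⁸ (conjugate-linear in the first slot). -/
def cinner8 (ψ v : Fin 8 → ℂ) : ℂ := ∑ i, starRingEnd ℂ (ψ i) * v i

/-- `w ∈ ℂ⁸` is a unit vector. -/
def unit8 (w : Fin 8 → ℂ) : Prop := ∑ i, ‖w i‖ ^ 2 = 1

/-- The canonical generalized three-qubit Schmidt state
`ψ_S = λ₁|↑↑↑⟩ + λ₂e^{iφ}|↑↓↓⟩ + λ₃|↓↑↓⟩ + λ₄|↓↓↑⟩ + λ₅|↓↓↓⟩`. -/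
def genSchmidt (lam1 lam2 lam3 lam4 lam5 φ : ℝ) : Fin 8 → ℂ :=
  (lam1 : ℂ) • vkron3 e0 e0 e0
    + ((lam2 : ℂ) * Complex.exp (φ * Complex.I)) • vkron3 e0 e1 e1
    + (lam3 : ℂ) • vkron3 e1 e0 e1
    + (lam4 : ℂ) • vkron3 e1 e1 e0
    + (lam5 : ℂ) • vkron3 e1 e1 e1

section ExpEntries

attribute [local instance] Matrix.linftyOpNormedRing Matrix.linftyOpNormedAlgebra

/-- Each entry of `s ↦ exp (s • A)` has derivative the corresponding entry of `A` at `s = 0`. -/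
lemma hasDerivAt_exp_smul_apply_zero {n : Type*} [Fintype n] [DecidableEq n]
    (A : Matrix n n ℂ) (i j : n) :
    HasDerivAt (fun s : ℝ => NormedSpace.exp (s • A) i j) (A i j) 0 := by
  have h := hasDerivAt_exp_smul_const (𝕂 := ℝ) A (0 : ℝ)
  rw [zero_smul, NormedSpace.exp_zero, one_mul] at h
  exact (Matrix.entryLinearMap ℝ ℂ i j).toContinuousLinearMap.hasFDerivAt.comp_hasDerivAt
    (0 : ℝ) h

end ExpEntries

/-- The diagonal of an anti-Hermitian matrix is purely imaginary. -/
lemma re_apply_self_eq_zero {n : Type*} {A : Matrix n n ℂ} (hA : Aᴴ = -A) (i : n) :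
    (A i i).re = 0 := by
  have h := congrArg Complex.re (congrFun (congrFun hA i) i)
  simp only [Matrix.conjTranspose_apply, Matrix.neg_apply, Complex.neg_re, Complex.star_def,
    Complex.conj_re] at h
  linarith

/-- The overlap of the generalized Schmidt state with a locally transformed `e₀⊗e₀⊗e₀`. -/
lemma cinner8_genSchmidt_mkron3 (lam1 lam2 lam3 lam4 lam5 φ : ℝ)
    (U V W : Matrix (Fin 2) (Fin 2) ℂ) :
    cinner8 (genSchmidt lam1 lam2 lam3 lam4 lam5 φ) ((mkron3 U V W).mulVec (vkron3 e0 e0 e0)) =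
      lam1 * (U 0 0 * V 0 0 * W 0 0)
        + lam2 * starRingEnd ℂ (Complex.exp (φ * Complex.I)) * (U 0 0 * V 1 0 * W 1 0)
        + lam3 * (U 1 0 * V 0 0 * W 1 0)
        + lam4 * (U 1 0 * V 1 0 * W 0 0)
        + lam5 * (U 1 0 * V 1 0 * W 1 0) := by
  simp [cinner8, genSchmidt, mkron3, vkron3, e0, e1, p1, p2, p3, Matrix.mulVec, dotProduct,
    Fin.sum_univ_eight]

/-- `e₀⊗e₀⊗e₀` is a stationary point of the fidelity with the generalized
three-qubit Schmidt state under local unitary transformations: for all anti-Hermitian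
`A₁, A₂, A₃`, the derivative at `s = 0` of
`s ↦ |⟨ψ_S, (exp(sA₁)⊗exp(sA₂)⊗exp(sA₃))·(e₀⊗e₀⊗e₀)⟩|²` is zero. -/
theorem genSchmidt_up_up_up_stationary
    (lam1 lam2 lam3 lam4 lam5 φ : ℝ)
    (h1 : 0 ≤ lam1) (h2 : 0 ≤ lam2) (h3 : 0 ≤ lam3) (h4 : 0 ≤ lam4) (h5 : 0 ≤ lam5)
    (hnorm : lam1 ^ 2 + lam2 ^ 2 + lam3 ^ 2 + lam4 ^ 2 + lam5 ^ 2 = 1)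
    (A₁ A₂ A₃ : Matrix (Fin 2) (Fin 2) ℂ)
    (hA₁ : A₁ᴴ = -A₁) (hA₂ : A₂ᴴ = -A₂) (hA₃ : A₃ᴴ = -A₃) :
    deriv
      (fun s : ℝ =>
        ‖cinner8 (genSchmidt lam1 lam2 lam3 lam4 lam5 φ)
          ((mkron3 (NormedSpace.exp (s • A₁)) (NormedSpace.exp (s • A₂))
              (NormedSpace.exp (s • A₃))).mulVec (vkron3 e0 e0 e0))‖ ^ 2)
      0 = 0 := by
  simp only [cinner8_genSchmidt_mkron3]
  have a := hasDerivAt_exp_smul_apply_zero A₁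
  have b := hasDerivAt_exp_smul_apply_zero A₂
  have c := hasDerivAt_exp_smul_apply_zero A₃
  have hf := ((((((a 0 0).mul (b 0 0)).mul (c 0 0)).const_mul (lam1 : ℂ)).add
    ((((a 0 0).mul (b 1 0)).mul (c 1 0)).const_mul
      (lam2 * starRingEnd ℂ (Complex.exp (φ * Complex.I))))).add
    ((((a 1 0).mul (b 0 0)).mul (c 1 0)).const_mul (lam3 : ℂ))).add
    ((((a 1 0).mul (b 1 0)).mul (c 0 0)).const_mul (lam4 : ℂ)) |>.add
    ((((a 1 0).mul (b 1 0)).mul (c 1 0)).const_mul (lam5 : ℂ))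
  refine hf.norm_sq.deriv.trans ?_
  simp [Complex.inner, re_apply_self_eq_zero hA₁, re_apply_self_eq_zero hA₂,
    re_apply_self_eq_zero hA₃]
end
end
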